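/- The Weyl group W(E₇) is isomorphic to the direct product Sp₆(𝔽₂) × ℤ/2, where the ℤ/2 factor is generated by the central element −1 (acting as negation on the E₇ root lattice). -/

import Mathlib

noncomputable section

/-- The intersection form on `H₇ = ℤH ⊕ ℤE₁ ⊕ ⋯ ⊕ ℤE₇`, realized as `Fin 8 → ℤ`
with coordinate `0` corresponding to `H`. -/
def interForm (x y : Fin 8 → ℤ) : ℤ := x 0 * y 0 - ∑ i : Fin 7, x i.succ * y i.succ

/-- The canonical class `K₇ = -3H + E₁ + ⋯ + E₇`. -/
def Kcl : Fin 8 → ℤ := fun i => if i = 0 then -3 else 1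

/-- The Weyl group `W(E₇)`, generated by the reflections
`σ_β(x) = x + (x·β)β` in the roots `β` of the `E₇` root system
`Φ = {β ∈ K₇^⊥ : β·β = -2}`. -/
def WeylE7 : Subgroup ((Fin 8 → ℤ) ≃ₗ[ℤ] (Fin 8 → ℤ)) :=
  Subgroup.closure {σ | ∃ β : Fin 8 → ℤ,
    (interForm β Kcl = 0 ∧ interForm β β = -2) ∧
    ∀ x : Fin 8 → ℤ, σ x = x + interForm x β • β}

/-- The standard symplectic form on the 6-dimensional `𝔽₂`-vector space
`(Fin 3 → 𝔽₂) × (Fin 3 → 𝔽₂)`. -/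
def Ω (x y : (Fin 3 → ZMod 2) × (Fin 3 → ZMod 2)) : ZMod 2 :=
  ∑ i : Fin 3, (x.1 i * y.2 i + x.2 i * y.1 i)

/-- The symplectic group `Sp₆(𝔽₂)` of linear automorphisms preserving `Ω`. -/
def Sp6 : Subgroup (((Fin 3 → ZMod 2) × (Fin 3 → ZMod 2)) ≃ₗ[ZMod 2]
    ((Fin 3 → ZMod 2) × (Fin 3 → ZMod 2))) where
  carrier := {σ | ∀ x y, Ω (σ x) (σ y) = Ω x y}
  one_mem' := fun _ _ => rfl
  mul_mem' := by
    intro a b ha hb x y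
    rw [show (a * b) x = a (b x) from rfl, show (a * b) y = a (b y) from rfl, ha, hb]
  inv_mem' := by
    intro a ha x y
    have h1 : a (a⁻¹ x) = x := a.apply_symm_apply x
    have h2 : a (a⁻¹ y) = y := a.apply_symm_apply y
    calc Ω (a⁻¹ x) (a⁻¹ y) = Ω (a (a⁻¹ x)) (a (a⁻¹ y)) := (ha _ _).symm
      _ = Ω x y := by rw [h1, h2]

end

section InterForm

variable {x : Fin 8 → ℤ}

lemma interForm_eq (x y : Fin 8 → ℤ) : interForm x y = x 0 * y 0 -
    (x 1 * y 1 + x 2 * y 2 + x 3 * y 3 + x 4 * y 4 + x 5 * y 5 + x 6 * y 6 + x 7 * y 7) := by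
  simp only [interForm, Fin.sum_univ_seven]
  rfl

lemma interForm_comm (x y : Fin 8 → ℤ) : interForm x y = interForm y x := by
  simp only [interForm, mul_comm]

/-- The intersection form as a bilinear form. -/
def interBilin : LinearMap.BilinForm ℤ (Fin 8 → ℤ) :=
  LinearMap.mk₂ ℤ interForm
    (fun x y z => by simp only [interForm_eq, Pi.add_apply]; ring)
    (fun c x y => by simp only [interForm_eq, Pi.smul_apply, smul_eq_mul]; ring)
    (fun x y z => by simp only [interForm_eq, Pi.add_apply]; ring)
    (fun c x y => by simp only [interForm_eq, Pi.smul_apply, smul_eq_mul]; ring)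

@[simp] lemma interBilin_apply (x y : Fin 8 → ℤ) : interBilin x y = interForm x y := rfl

lemma interForm_add_left (x y z : Fin 8 → ℤ) :
    interForm (x + y) z = interForm x z + interForm y z := by
  simp [← interBilin_apply]

lemma interForm_add_right (x y z : Fin 8 → ℤ) :
    interForm x (y + z) = interForm x y + interForm x z := by
  simp [← interBilin_apply]

lemma interForm_sub_left (x y z : Fin 8 → ℤ) :
    interForm (x - y) z = interForm x z - interForm y z := by
  simp [← interBilin_apply]

lemma interForm_sub_right (x y z : Fin 8 → ℤ) :
    interForm x (y - z) = interForm x y - interForm x z := by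
  simp [← interBilin_apply]

lemma interForm_smul_left (c : ℤ) (x y : Fin 8 → ℤ) :
    interForm (c • x) y = c * interForm x y := by
  simp only [← interBilin_apply, map_smul, LinearMap.smul_apply, smul_eq_mul]

lemma interForm_smul_right (c : ℤ) (x y : Fin 8 → ℤ) :
    interForm x (c • y) = c * interForm x y := by
  simp only [← interBilin_apply, map_smul, smul_eq_mul]

lemma interForm_Kcl_eq (x : Fin 8 → ℤ) :
    interForm x Kcl = -3 * x 0 - (x 1 + x 2 + x 3 + x 4 + x 5 + x 6 + x 7) := by
  simp [interForm_eq, Kcl]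
  ring

lemma interForm_Kcl_Kcl : interForm Kcl Kcl = 2 := by decide

/-- A sum-of-squares identity on the orthogonal complement of `Kcl`. -/
lemma neg_nine_mul_interForm_self (hx : interForm x Kcl = 0) :
    -9 * interForm x x = 2 * x 0 ^ 2 + ∑ i : Fin 7, (3 * x i.succ + x 0) ^ 2 := by
  rw [interForm_Kcl_eq] at hx
  rw [interForm_eq, Fin.sum_univ_seven]
  change _ = _ + ((3 * x 1 + x 0) ^ 2 + (3 * x 2 + x 0) ^ 2 + (3 * x 3 + x 0) ^ 2 +
      (3 * x 4 + x 0) ^ 2 + (3 * x 5 + x 0) ^ 2 + (3 * x 6 + x 0) ^ 2 + (3 * x 7 + x 0) ^ 2)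
  linear_combination 6 * x 0 * hx

/-- The intersection form is negative semidefinite on the orthogonal complement of `Kcl`. -/
lemma interForm_self_nonpos (hx : interForm x Kcl = 0) : interForm x x ≤ 0 := by
  have h := neg_nine_mul_interForm_self hx
  have : 0 ≤ ∑ i : Fin 7, (3 * x i.succ + x 0) ^ 2 := Finset.sum_nonneg fun i _ => sq_nonneg _
  nlinarith [sq_nonneg (x 0)]

/-- The intersection form is anisotropic on the orthogonal complement of `Kcl`. -/
lemma eq_zero_of_interForm_self_eq_zero (hx : interForm x Kcl = 0) (h0 : interForm x x = 0) :
    x = 0 := by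
  have h := neg_nine_mul_interForm_self hx
  have hs : 0 ≤ ∑ i : Fin 7, (3 * x i.succ + x 0) ^ 2 := Finset.sum_nonneg fun i _ => sq_nonneg _
  have hx0 : x 0 = 0 := by
    have : x 0 ^ 2 = 0 := by nlinarith [sq_nonneg (x 0)]
    simpa using this
  have hz : ∑ i : Fin 7, (3 * x i.succ + x 0) ^ 2 = 0 := by
    rw [h0, hx0] at h
    simpa [hx0] using h.symm
  rw [Finset.sum_eq_zero_iff_of_nonneg fun i _ => sq_nonneg _] at hz
  funext i
  refine Fin.cases hx0 (fun i => ?_) i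
  simpa [hx0] using hz i (Finset.mem_univ _)

/-- `Kcl` is characteristic, so the intersection form is even on its orthogonal complement. -/
lemma even_interForm_self_sub (x : Fin 8 → ℤ) : Even (interForm x x - interForm x Kcl) := by
  have h (a : ℤ) : Even (a * a - a) := by simp [← mul_sub_one, Int.even_mul_pred_self]
  rw [interForm_Kcl_eq, interForm_eq]
  have key : x 0 * x 0 - (x 1 * x 1 + x 2 * x 2 + x 3 * x 3 + x 4 * x 4 + x 5 * x 5 + x 6 * x 6 +
      x 7 * x 7) - (-3 * x 0 - (x 1 + x 2 + x 3 + x 4 + x 5 + x 6 + x 7)) =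
      (x 0 * x 0 - x 0) + 2 * (2 * x 0) - ((x 1 * x 1 - x 1) + (x 2 * x 2 - x 2) +
      (x 3 * x 3 - x 3) + (x 4 * x 4 - x 4) + (x 5 * x 5 - x 5) + (x 6 * x 6 - x 6) +
      (x 7 * x 7 - x 7)) := by ring
  rw [key]
  exact ((h _).add (even_two_mul _)).sub
    (((((((h _).add (h _)).add (h _)).add (h _)).add (h _)).add (h _)).add (h _))

end InterForm

section Reflection

/-- A root of the `E₇` root system. -/
def IsRoot (β : Fin 8 → ℤ) : Prop := interForm β Kcl = 0 ∧ interForm β β = -2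

instance (β : Fin 8 → ℤ) : Decidable (IsRoot β) := inferInstanceAs (Decidable (_ ∧ _))

/-- The reflection in a root. -/
def rootReflection {β : Fin 8 → ℤ} (hβ : IsRoot β) : (Fin 8 → ℤ) ≃ₗ[ℤ] (Fin 8 → ℤ) :=
  Module.reflection (x := β) (f := -interBilin β) (by simp [hβ.2])

lemma rootReflection_apply {β : Fin 8 → ℤ} (hβ : IsRoot β) (x : Fin 8 → ℤ) :
    rootReflection hβ x = x + interForm x β • β := by
  rw [rootReflection, Module.reflection_apply, LinearMap.neg_apply, interBilin_apply, neg_smul,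
    sub_neg_eq_add, interForm_comm]

lemma rootReflection_mem {β : Fin 8 → ℤ} (hβ : IsRoot β) : rootReflection hβ ∈ WeylE7 :=
  Subgroup.subset_closure ⟨β, hβ, rootReflection_apply hβ⟩

lemma det_rootReflection {β : Fin 8 → ℤ} (hβ : IsRoot β) :
    LinearEquiv.det (rootReflection hβ) = -1 := by
  have h : (rootReflection hβ : (Fin 8 → ℤ) →ₗ[ℤ] (Fin 8 → ℤ)) =
      LinearMap.transvection (interBilin β) β := by
    refine LinearMap.ext fun x => ?_
    rw [LinearEquiv.coe_coe, rootReflection_apply, LinearMap.transvection.apply, interBilin_apply,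
      interForm_comm]
  rw [Units.ext_iff, LinearEquiv.coe_det, h, LinearMap.transvection.det, interBilin_apply, hβ.2]
  rfl

variable {w : (Fin 8 → ℤ) ≃ₗ[ℤ] (Fin 8 → ℤ)}

lemma interForm_map_of_mem (hw : w ∈ WeylE7) (x y : Fin 8 → ℤ) :
    interForm (w x) (w y) = interForm x y := by
  induction hw using Subgroup.closure_induction generalizing x y with
  | mem σ h =>
    obtain ⟨β, hβ, hσ⟩ := h
    simp only [hσ, interForm_add_left, interForm_add_right, interForm_smul_left,
      interForm_smul_right, hβ.2, interForm_comm β y]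
    ring
  | one => rfl
  | mul a b _ _ ha hb => rw [LinearEquiv.mul_apply, LinearEquiv.mul_apply, ha, hb]
  | inv a _ ha =>
    rw [← ha]
    exact congrArg₂ _ (a.apply_symm_apply x) (a.apply_symm_apply y)

lemma map_Kcl_of_mem (hw : w ∈ WeylE7) : w Kcl = Kcl := by
  induction hw using Subgroup.closure_induction with
  | mem σ h =>
    obtain ⟨β, hβ, hσ⟩ := h
    rw [hσ, interForm_comm, hβ.1, zero_smul, add_zero]
  | one => rfl
  | mul a b _ _ ha hb => rw [LinearEquiv.mul_apply, hb, ha]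
  | inv a _ ha => exact a.symm_apply_eq.2 ha.symm

lemma interForm_map_Kcl_of_mem (hw : w ∈ WeylE7) (x : Fin 8 → ℤ) :
    interForm (w x) Kcl = interForm x Kcl := by
  rw [← interForm_map_of_mem hw x, map_Kcl_of_mem hw]

lemma IsRoot.map {β : Fin 8 → ℤ} (hβ : IsRoot β) (hw : w ∈ WeylE7) : IsRoot (w β) :=
  ⟨(interForm_map_Kcl_of_mem hw β).trans hβ.1, (interForm_map_of_mem hw β β).trans hβ.2⟩

/-- Seven pairwise orthogonal roots. -/
def orthogonalRoot : Fin 7 → Fin 8 → ℤ :=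
  ![![0, 1, -1, 0, 0, 0, 0, 0], ![0, 0, 0, 1, -1, 0, 0, 0], ![0, 0, 0, 0, 0, 1, -1, 0],
    ![2, -1, -1, -1, -1, -1, -1, 0], ![1, 0, 0, 0, 0, -1, -1, -1], ![1, 0, 0, -1, -1, 0, 0, -1],
    ![1, -1, -1, 0, 0, 0, 0, -1]]

/-- Negation on the orthogonal complement of `Kcl` is a product of seven orthogonal reflections. -/
lemma exists_neg_mem_WeylE7 : ∃ w ∈ WeylE7, LinearEquiv.det w = -1 ∧
    ∀ x, w x = interForm x Kcl • Kcl - x := by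
  have hr : ∀ i, IsRoot (orthogonalRoot i) := by decide
  have ho : ∀ i j, i ≠ j → interForm (orthogonalRoot i) (orthogonalRoot j) = 0 := by decide
  refine ⟨rootReflection (hr 0) * rootReflection (hr 1) * rootReflection (hr 2) *
    rootReflection (hr 3) * rootReflection (hr 4) * rootReflection (hr 5) * rootReflection (hr 6),
    ?_, ?_, fun x => ?_⟩
  · exact mul_mem (mul_mem (mul_mem (mul_mem (mul_mem (mul_mem (rootReflection_mem _)
      (rootReflection_mem _)) (rootReflection_mem _)) (rootReflection_mem _))
      (rootReflection_mem _)) (rootReflection_mem _)) (rootReflection_mem _)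
  · simp only [map_mul, det_rootReflection]
    rfl
  · simp only [LinearEquiv.mul_apply, rootReflection_apply, interForm_add_left,
      interForm_smul_left, ne_eq, Fin.reduceEq, not_false_eq_true, ho, mul_zero, add_zero]
    funext i
    fin_cases i <;>
      simp [interForm_eq, Kcl, orthogonalRoot, Matrix.vecHead, Matrix.vecTail] <;> ring

end Reflection

section Symplectic

/-- The six-dimensional space over `𝔽₂` carrying the form `Ω`. -/
abbrev SympSpace : Type := (Fin 3 → ZMod 2) × (Fin 3 → ZMod 2)

lemma Ω_add_left (x y z : SympSpace) : Ω (x + y) z = Ω x z + Ω y z := by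
  simp only [Ω, ← Finset.sum_add_distrib, Prod.fst_add, Prod.snd_add, Pi.add_apply]
  exact Finset.sum_congr rfl fun i _ => by ring

lemma Ω_comm (x y : SympSpace) : Ω x y = Ω y x :=
  Finset.sum_congr rfl fun i _ => by ring

lemma Ω_add_right (x y z : SympSpace) : Ω x (y + z) = Ω x y + Ω x z := by
  rw [Ω_comm, Ω_add_left, Ω_comm y, Ω_comm z]

@[simp] lemma Ω_self (x : SympSpace) : Ω x x = 0 :=
  Finset.sum_eq_zero fun i _ => by rw [mul_comm, CharTwo.add_self_eq_zero]

lemma SympSpace.add_self (x : SympSpace) : x + x = 0 := by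
  ext i <;> exact CharTwo.add_self_eq_zero _

variable {G : Subgroup (SympSpace ≃ₗ[ZMod 2] SympSpace)}

/-- If `Ω y x = 1`, or if some `z` pairs to `1` with both of `x` and `y`, then at most two
transvections move `y` to `x`. They fix the vectors of `S` if these have the same pairing with
`x`, `y` and `z`. -/
lemma exists_map_eq_of_transvections
    (hT : ∀ v, ∃ g ∈ G, ∀ u, g u = u + Ω u v • v) {S : List SympSpace} {x y : SympSpace}
    (hS : ∀ s ∈ S, Ω s y = Ω s x)
    (h : y = x ∨ Ω y x = 1 ∨ ∃ z, Ω y z = 1 ∧ Ω z x = 1 ∧ ∀ s ∈ S, Ω s z = Ω s x) :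
    ∃ g ∈ G, g y = x ∧ ∀ s ∈ S, g s = s := by
  have step {a b : SympSpace} (hab : Ω a b = 1) (hs : ∀ s ∈ S, Ω s a = Ω s b) :
      ∃ g ∈ G, g a = b ∧ ∀ s ∈ S, g s = s := by
    obtain ⟨g, hg, hgu⟩ := hT (a + b)
    refine ⟨g, hg, ?_, fun s h => ?_⟩
    · rw [hgu, Ω_add_right, Ω_self, hab, zero_add, one_smul, ← add_assoc, SympSpace.add_self,
        zero_add]
    · rw [hgu, Ω_add_right, hs s h, CharTwo.add_self_eq_zero, zero_smul, add_zero]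
  obtain rfl | h | ⟨z, hyz, hzx, hz⟩ := h
  · exact ⟨1, one_mem _, rfl, fun _ _ => rfl⟩
  · exact step h hS
  · obtain ⟨g, hg, hgy, hgs⟩ := step hyz fun s h => (hS s h).trans (hz s h).symm
    obtain ⟨k, hk, hkz, hks⟩ := step hzx hz
    refine ⟨k * g, mul_mem hk hg, ?_, fun s h => ?_⟩
    · rw [LinearEquiv.mul_apply, hgy, hkz]
    · rw [LinearEquiv.mul_apply, hgs s h, hks s h]

/-- If the symplectic maps fixing `x` and `S` lie in `G`, so do those fixing only `S`. -/
lemma mem_of_forall_cons_mem (hG : G ≤ Sp6)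
    (hT : ∀ v, ∃ g ∈ G, ∀ u, g u = u + Ω u v • v) {S : List SympSpace} {x : SympSpace}
    (hx : x ≠ 0)
    (h : ∀ y, y ≠ 0 → (∀ s ∈ S, Ω s y = Ω s x) →
      y = x ∨ Ω y x = 1 ∨ ∃ z, Ω y z = 1 ∧ Ω z x = 1 ∧ ∀ s ∈ S, Ω s z = Ω s x)
    (hxS : ∀ σ ∈ Sp6, (∀ s ∈ x :: S, σ s = s) → σ ∈ G) :
    ∀ σ ∈ Sp6, (∀ s ∈ S, σ s = s) → σ ∈ G := by
  intro σ hσ hσS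
  have hS : ∀ s ∈ S, Ω s (σ x) = Ω s x := fun s hs => by
    conv_lhs => rw [← hσS s hs]
    exact hσ s x
  obtain ⟨g, hg, hgx, hgS⟩ := exists_map_eq_of_transvections hT hS
    (h _ ((LinearEquiv.map_ne_zero_iff σ).2 hx) hS)
  refine (Subgroup.mul_mem_cancel_left G hg).1
    (hxS (g * σ) (mul_mem (hG hg) hσ) (List.forall_mem_cons.2 ⟨hgx, fun s hs => ?_⟩))
  rw [LinearEquiv.mul_apply, hσS s hs, hgS s hs]

set_option synthInstance.maxHeartbeats 200000 in
set_option synthInstance.maxSize 1000 in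
/-- `Sp₆(𝔽₂)` is generated by symplectic transvections. -/
theorem Sp6_le_of_transvections_mem (hG : G ≤ Sp6)
    (hT : ∀ v, ∃ g ∈ G, ∀ u, g u = u + Ω u v • v) : Sp6 ≤ G := by
  intro σ hσ
  refine mem_of_forall_cons_mem (x := (![1, 0, 0], 0)) (S := []) hG hT ?_ ?_ ?_ σ hσ (by simp)
  · decide
  · decide +kernel
  refine mem_of_forall_cons_mem (x := (0, ![1, 0, 0])) hG hT ?_ ?_ ?_
  · decide
  · decide +kernel
  refine mem_of_forall_cons_mem (x := (![0, 1, 0], 0)) hG hT ?_ ?_ ?_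
  · decide
  · decide +kernel
  refine mem_of_forall_cons_mem (x := (0, ![0, 1, 0])) hG hT ?_ ?_ ?_
  · decide
  · decide +kernel
  refine mem_of_forall_cons_mem (x := (![0, 0, 1], 0)) hG hT ?_ ?_ ?_
  · decide
  · decide +kernel
  refine mem_of_forall_cons_mem (x := (0, ![0, 0, 1])) hG hT ?_ ?_ ?_
  · decide
  · decide +kernel
  intro τ _ hτ
  convert one_mem G
  simp only [List.mem_cons, List.not_mem_nil, or_false, forall_eq_or_imp, forall_eq] at hτ
  obtain ⟨h₁, h₂, h₃, h₄, h₅, h₆⟩ := hτ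
  refine LinearEquiv.toLinearMap_injective (LinearMap.prod_ext ?_ ?_) <;>
    refine LinearMap.pi_ext' fun i => LinearMap.ext_ring ?_
  · change τ (Pi.single i 1, 0) = (Pi.single i 1, 0)
    fin_cases i
    · convert h₆ using 3 <;> decide
    · convert h₄ using 3 <;> decide
    · convert h₂ using 3 <;> decide
  · change τ (0, Pi.single i 1) = (0, Pi.single i 1)
    fin_cases i
    · convert h₅ using 3 <;> decide
    · convert h₃ using 3 <;> decide
    · convert h₁ using 3 <;> decide

end Symplectic

section Reduction

/-- Roots which, together with `dualRoot`, reduce to a symplectic basis of `SympSpace`. -/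
def basisRoot : Fin 3 → Fin 8 → ℤ :=
  ![![0, 1, -1, 0, 0, 0, 0, 0], ![0, 0, 0, 0, 1, -1, 0, 0], ![2, -1, -1, -1, -1, -1, -1, 0]]

/-- Roots which, together with `basisRoot`, reduce to a symplectic basis of `SympSpace`. -/
def dualRoot : Fin 3 → Fin 8 → ℤ :=
  ![![0, 0, 1, -1, 0, 0, 0, 0], ![0, 0, 0, 0, 0, 1, -1, 0], ![1, -1, -1, -1, 0, 0, 0, 0]]

/-- Reduction of the root lattice modulo `2` and modulo its radical, in the coordinates given by
`basisRoot` and `dualRoot`. -/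
def reduction : (Fin 8 → ℤ) →+ SympSpace where
  toFun x := (fun i => interForm x (dualRoot i), fun i => interForm x (basisRoot i))
  map_zero' := by ext i <;> simp [← interBilin_apply]
  map_add' x y := by ext i <;> simp [interForm_add_left]

lemma reduction_apply (x : Fin 8 → ℤ) : reduction x =
    (fun i => (interForm x (dualRoot i) : ZMod 2), fun i => (interForm x (basisRoot i) : ZMod 2)) :=
  rfl

lemma isRoot_basisRoot (i : Fin 3) : IsRoot (basisRoot i) := by revert i; decide

lemma isRoot_dualRoot (i : Fin 3) : IsRoot (dualRoot i) := by revert i; decide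

variable {x y : Fin 8 → ℤ}

/-- The reduction is compatible with the forms. -/
lemma Ω_reduction (hx : interForm x Kcl = 0) (hy : interForm y Kcl = 0) :
    Ω (reduction x) (reduction y) = interForm x y := by
  rw [interForm_Kcl_eq] at hx hy
  have hx7 : x 7 = -3 * x 0 - (x 1 + x 2 + x 3 + x 4 + x 5 + x 6) := by linarith
  have hy7 : y 7 = -3 * y 0 - (y 1 + y 2 + y 3 + y 4 + y 5 + y 6) := by linarith
  simp [Ω, reduction_apply, Fin.sum_univ_three, interForm_eq, basisRoot, dualRoot, hx7, hy7]
  ring_nf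
  reduce_mod_char

lemma exists_of_reduction_eq_zero (hx : interForm x Kcl = 0) (h : reduction x = 0) :
    ∃ u, x = (2 : ℤ) • u ∨ x = (2 : ℤ) • u + Kcl := by
  rw [interForm_Kcl_eq] at hx
  have h₁ (i : Fin 3) : 2 ∣ interForm x (dualRoot i) :=
    (ZMod.intCast_zmod_eq_zero_iff_dvd _ 2).1 (congrFun (congrArg Prod.fst h) i)
  have h₂ (i : Fin 3) : 2 ∣ interForm x (basisRoot i) :=
    (ZMod.intCast_zmod_eq_zero_iff_dvd _ 2).1 (congrFun (congrArg Prod.snd h) i)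
  simp [Fin.forall_fin_succ, interForm_eq, basisRoot, dualRoot] at h₁ h₂
  obtain ⟨h₁₁, h₁₂, h₁₃⟩ := h₁
  obtain ⟨h₂₁, h₂₂, h₂₃⟩ := h₂
  have h1 : x 1 % 2 = x 0 % 2 := by omega
  have h2 : x 2 % 2 = x 0 % 2 := by omega
  have h3 : x 3 % 2 = x 0 % 2 := by omega
  have h4 : x 4 % 2 = x 0 % 2 := by omega
  have h5 : x 5 % 2 = x 0 % 2 := by omega
  have h6 : x 6 % 2 = x 0 % 2 := by omega
  clear h₁₁ h₁₂ h₁₃ h₂₁ h₂₂ h₂₃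
  have h7 : x 7 % 2 = x 0 % 2 := by omega
  have hpar (i : Fin 8) : x i % 2 = x 0 % 2 := by
    fin_cases i
    exacts [rfl, h1, h2, h3, h4, h5, h6, h7]
  have hKcl : ∀ i, Kcl i % 2 = 1 := by decide
  rcases Int.emod_two_eq_zero_or_one (x 0) with h0 | h0
  · refine ⟨fun i => x i / 2, Or.inl (funext fun i => ?_)⟩
    have := hpar i
    change x i = 2 * (x i / 2)
    omega
  · refine ⟨fun i => (x i - Kcl i) / 2, Or.inr (funext fun i => ?_)⟩
    have := hpar i
    have := hKcl i
    change x i = 2 * ((x i - Kcl i) / 2) + Kcl i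
    omega

/-- Congruent roots agree up to sign. -/
lemma IsRoot.eq_or_eq_neg_of_reduction_eq {β γ : Fin 8 → ℤ} (hβ : IsRoot β) (hγ : IsRoot γ)
    (h : reduction β = reduction γ) : β = γ ∨ β = -γ := by
  have hK : interForm (β - γ) Kcl = 0 := by rw [interForm_sub_left, hβ.1, hγ.1, sub_zero]
  have hK' : interForm (β + γ) Kcl = 0 := by rw [interForm_add_left, hβ.1, hγ.1, add_zero]
  have hsub : interForm (β - γ) (β - γ) = -4 - 2 * interForm β γ := by
    rw [interForm_sub_left, interForm_sub_right, interForm_sub_right, hβ.2, hγ.2,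
      interForm_comm γ]
    ring
  have hadd : interForm (β + γ) (β + γ) = -4 + 2 * interForm β γ := by
    rw [interForm_add_left, interForm_add_right, interForm_add_right, hβ.2, hγ.2,
      interForm_comm γ]
    ring
  have h₁ := interForm_self_nonpos hK
  have h₂ := interForm_self_nonpos hK'
  have heven : (2 : ℤ) ∣ interForm β γ := by
    refine (ZMod.intCast_zmod_eq_zero_iff_dvd _ 2).1 ?_
    rw [← Ω_reduction hβ.1 hγ.1, h, Ω_self]
  obtain ⟨u, hu | hu⟩ := exists_of_reduction_eq_zero hK (by rw [map_sub, h, sub_self])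
  · have hu2 := even_interForm_self_sub u
    have huK : interForm u Kcl = 0 := by
      rw [hu, interForm_smul_left] at hK
      omega
    rw [huK, sub_zero] at hu2
    have h4 : interForm (β - γ) (β - γ) = 4 * interForm u u := by
      rw [hu, interForm_smul_left, interForm_smul_right]
      ring
    have : interForm β γ = -2 ∨ interForm β γ = 2 := by
      obtain ⟨k, hk⟩ := hu2
      omega
    rcases this with h | h
    · exact Or.inl (sub_eq_zero.1 (eq_zero_of_interForm_self_eq_zero hK (by omega)))
    · exact Or.inr (eq_neg_of_add_eq_zero_left (eq_zero_of_interForm_self_eq_zero hK' (by omega)))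
  · exfalso
    have h4 : interForm (β - γ) (β - γ) = 4 * interForm u u + 4 * interForm u Kcl + 2 := by
      rw [hu, interForm_add_left, interForm_add_right, interForm_add_right, interForm_Kcl_Kcl,
        interForm_smul_left, interForm_smul_left, interForm_smul_right, interForm_smul_right,
        interForm_comm Kcl]
      ring
    omega

/-- The integral lift of a vector of `SympSpace` along `reduction`. -/
def lift (v : SympSpace) : Fin 8 → ℤ :=
  ∑ i, ((v.1 i).val : ℤ) • basisRoot i + ∑ i, ((v.2 i).val : ℤ) • dualRoot i

lemma interForm_lift_Kcl (v : SympSpace) : interForm (lift v) Kcl = 0 := by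
  simp only [lift, interForm_add_left, Fin.sum_univ_three, interForm_smul_left,
    (isRoot_basisRoot _).1, (isRoot_dualRoot _).1, mul_zero, add_zero]

lemma reduction_basisRoot (i : Fin 3) : reduction (basisRoot i) = (Pi.single i 1, 0) := by
  revert i; decide +kernel

lemma reduction_dualRoot (i : Fin 3) : reduction (dualRoot i) = (0, Pi.single i 1) := by
  revert i; decide +kernel

@[simp] lemma reduction_lift (v : SympSpace) : reduction (lift v) = v := by
  simp only [lift, map_add, map_sum, natCast_zsmul, map_nsmul, reduction_basisRoot,
    reduction_dualRoot]
  ext i <;> simp [Pi.single_apply, Prod.fst_sum, Prod.snd_sum, -nsmul_eq_mul, Pi.smul_apply]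

end Reduction

section Representation

variable {w : (Fin 8 → ℤ) ≃ₗ[ℤ] (Fin 8 → ℤ)} {x : Fin 8 → ℤ}

lemma reduction_eq_zero_iff (hx : interForm x Kcl = 0) :
    reduction x = 0 ↔ ∀ y, interForm y Kcl = 0 → (interForm x y : ZMod 2) = 0 := by
  refine ⟨fun h y hy => ?_, fun h => ?_⟩
  · rw [← Ω_reduction hx hy, h]
    simp [Ω]
  · ext i
    · exact h _ (isRoot_dualRoot i).1
    · exact h _ (isRoot_basisRoot i).1

lemma reduction_map_eq_zero (hw : w ∈ WeylE7) (hx : interForm x Kcl = 0) (h : reduction x = 0) :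
    reduction (w x) = 0 := by
  rw [reduction_eq_zero_iff ((interForm_map_Kcl_of_mem hw x).trans hx)]
  intro y hy
  have hy' : interForm (w⁻¹ y) Kcl = 0 := (interForm_map_Kcl_of_mem (inv_mem hw) y).trans hy
  rw [← (reduction_eq_zero_iff hx).1 h _ hy', ← interForm_map_of_mem hw x,
    show w (w⁻¹ y) = y from w.apply_symm_apply y]

lemma reduction_map_lift (hw : w ∈ WeylE7) (hx : interForm x Kcl = 0) :
    reduction (w (lift (reduction x))) = reduction (w x) := by
  rw [← sub_eq_zero, ← map_sub, ← map_sub]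
  refine reduction_map_eq_zero hw ?_ ?_
  · rw [interForm_sub_left, interForm_lift_Kcl, hx, sub_zero]
  · rw [map_sub, reduction_lift, sub_self]

lemma reduction_map_lift_add (hw : w ∈ WeylE7) (u v : SympSpace) :
    reduction (w (lift (u + v))) = reduction (w (lift u)) + reduction (w (lift v)) := by
  have h := reduction_map_lift hw (x := lift u + lift v)
    (by rw [interForm_add_left, interForm_lift_Kcl, interForm_lift_Kcl, add_zero])
  rwa [map_add, reduction_lift, reduction_lift, map_add, map_add] at h

/-- The action of the Weyl group on `SympSpace`. -/
def symplecticAction (w : WeylE7) : SympSpace ≃ₗ[ZMod 2] SympSpace where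
  __ := AddMonoidHom.toZModLinearMap 2
    (AddMonoidHom.mk' (fun v => reduction (w.1 (lift v))) (reduction_map_lift_add w.2))
  invFun v := reduction (w.1⁻¹ (lift v))
  left_inv v := by
    refine (reduction_map_lift (inv_mem w.2)
      ((interForm_map_Kcl_of_mem w.2 _).trans (interForm_lift_Kcl v))).trans ?_
    rw [show w.1⁻¹ (w.1 (lift v)) = lift v from w.1.symm_apply_apply _, reduction_lift]
  right_inv v := by
    refine (reduction_map_lift w.2
      ((interForm_map_Kcl_of_mem (inv_mem w.2) _).trans (interForm_lift_Kcl v))).trans ?_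
    rw [show w.1 (w.1⁻¹ (lift v)) = lift v from w.1.apply_symm_apply _, reduction_lift]

lemma symplecticAction_apply (w : WeylE7) (v : SympSpace) :
    symplecticAction w v = reduction (w.1 (lift v)) := rfl

lemma symplecticAction_reduction (w : WeylE7) (hx : interForm x Kcl = 0) :
    symplecticAction w (reduction x) = reduction (w.1 x) :=
  reduction_map_lift w.2 hx

/-- The homomorphism from the Weyl group to `Sp₆(𝔽₂)` given by the action on `SympSpace`. -/
def symplecticRep : WeylE7 →* Sp6 where
  toFun w := ⟨symplecticAction w, fun u v => by
    have h (w : WeylE7) (v : SympSpace) : interForm (w.1 (lift v)) Kcl = 0 :=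
      (interForm_map_Kcl_of_mem w.2 _).trans (interForm_lift_Kcl v)
    rw [symplecticAction_apply, symplecticAction_apply, Ω_reduction (h w u) (h w v),
      interForm_map_of_mem w.2, ← Ω_reduction (interForm_lift_Kcl u) (interForm_lift_Kcl v),
      reduction_lift, reduction_lift]⟩
  map_one' := Subtype.ext (LinearEquiv.ext fun v => reduction_lift v)
  map_mul' a b := Subtype.ext (LinearEquiv.ext fun v => (reduction_map_lift a.2
    ((interForm_map_Kcl_of_mem b.2 _).trans (interForm_lift_Kcl v))).symm)

lemma symplecticRep_reduction (w : WeylE7) (hx : interForm x Kcl = 0) :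
    (symplecticRep w).1 (reduction x) = reduction (w.1 x) :=
  symplecticAction_reduction w hx

lemma symplecticRep_rootReflection {β : Fin 8 → ℤ} (hβ : IsRoot β) (v : SympSpace) :
    (symplecticRep ⟨_, rootReflection_mem hβ⟩).1 v = v + Ω v (reduction β) • reduction β := by
  change reduction (rootReflection hβ (lift v)) = _
  rw [rootReflection_apply, map_add, reduction_lift, map_zsmul]
  conv_rhs => rw [← reduction_lift v, Ω_reduction (interForm_lift_Kcl v) hβ.1, reduction_lift,
    Int.cast_smul_eq_zsmul]

/-- The root attached to a vector of `{0, 1}⁸` of weight `2`, `4` or `6`: it is congruent to the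
vector or to its complement modulo `2`. -/
def rootOfBits (b : Fin 8 → ℤ) : Fin 8 → ℤ :=
  let weight := ∑ i, b i
  let c : Fin 8 → ℤ := if weight = 4 ∧ b 0 = 0 ∨ weight ≠ 4 ∧ b 0 = 1 then 1 - b else b
  match ∑ i, c i with
  | 2 => fun i => if ∑ j with j < i, c j = 0 then c i else -c i
  | 4 => fun i => if i = 0 then 1 else -c i
  | _ => fun i => if i = 0 then 2 else -c i

/-- Every nonzero vector of `SympSpace` is the reduction of a root. -/
lemma exists_root_reduction_eq (v : SympSpace) (hv : v ≠ 0) : ∃ β, IsRoot β ∧ reduction β = v := by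
  suffices h : ∀ v : SympSpace, v ≠ 0 → IsRoot (rootOfBits fun i => lift v i % 2) ∧
      reduction (rootOfBits fun i => lift v i % 2) = v from ⟨_, h v hv⟩
  decide +kernel

theorem symplecticRep_surjective : Function.Surjective symplecticRep := by
  have hle : Sp6 ≤ (Sp6.subtype.comp symplecticRep).range := by
    refine Sp6_le_of_transvections_mem ?_ fun v => ?_
    · rintro _ ⟨w, rfl⟩
      exact (symplecticRep w).2
    · by_cases hv : v = 0
      · exact ⟨1, one_mem _, fun u => by simp [hv]⟩
      · obtain ⟨β, hβ, rfl⟩ := exists_root_reduction_eq v hv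
        exact ⟨_, ⟨⟨_, rootReflection_mem hβ⟩, rfl⟩, symplecticRep_rootReflection hβ⟩
  intro σ
  obtain ⟨w, hw⟩ := hle σ.2
  exact ⟨w, Subtype.ext hw⟩

end Representation

section Kernel

variable {w : (Fin 8 → ℤ) ≃ₗ[ℤ] (Fin 8 → ℤ)}

/-- Simple roots of `E₇`, ordered so that the first is adjacent to the second in the Dynkin
diagram. -/
def simpleRoot : Fin 7 → Fin 8 → ℤ :=
  ![![1, -1, -1, -1, 0, 0, 0, 0], ![0, 0, 0, 1, -1, 0, 0, 0], ![0, 0, 1, -1, 0, 0, 0, 0],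
    ![0, 1, -1, 0, 0, 0, 0, 0], ![0, 0, 0, 0, 1, -1, 0, 0], ![0, 0, 0, 0, 0, 1, -1, 0],
    ![0, 0, 0, 0, 0, 0, 1, -1]]

lemma isRoot_simpleRoot (i : Fin 7) : IsRoot (simpleRoot i) := by revert i; decide

/-- The simple roots span the orthogonal complement of `Kcl`. -/
lemma eq_sum_simpleRoot {x : Fin 8 → ℤ} (hx : interForm x Kcl = 0) :
    ∃ c : Fin 7 → ℤ, x = ∑ i, c i • simpleRoot i := by
  rw [interForm_Kcl_eq] at hx
  refine ⟨![x 0, x 1 + x 2 + x 3 + 3 * x 0, x 1 + x 2 + 2 * x 0, x 1 + x 0,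
    x 1 + x 2 + x 3 + x 4 + 3 * x 0, x 1 + x 2 + x 3 + x 4 + x 5 + 3 * x 0,
    x 1 + x 2 + x 3 + x 4 + x 5 + x 6 + 3 * x 0], funext fun i => ?_⟩
  simp only [Fin.sum_univ_seven]
  fin_cases i <;> simp [simpleRoot] <;> linarith

lemma map_root_eq_or_eq_neg (hw : w ∈ WeylE7)
    (hker : ∀ x, interForm x Kcl = 0 → reduction (w x) = reduction x)
    {β : Fin 8 → ℤ} (hβ : IsRoot β) : w β = β ∨ w β = -β :=
  (hβ.map hw).eq_or_eq_neg_of_reduction_eq hβ (hker β hβ.1)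

/-- An element acting trivially on `SympSpace` acts by the same sign on non-orthogonal roots. -/
lemma map_root_eq_smul_of_adjacent (hw : w ∈ WeylE7)
    (hker : ∀ x, interForm x Kcl = 0 → reduction (w x) = reduction x)
    {β γ : Fin 8 → ℤ} (hγ : IsRoot γ) (hβγ : interForm β γ ≠ 0) {ε : ℤˣ}
    (h : w β = (ε : ℤ) • β) : w γ = (ε : ℤ) • γ := by
  have hf := interForm_map_of_mem hw β γ
  rcases Int.units_eq_one_or ε with rfl | rfl <;>
    rcases map_root_eq_or_eq_neg hw hker hγ with h' | h' <;>
    simp [h, h', ← interBilin_apply] at hf hβγ ⊢ <;> omega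

/-- An element acting trivially on `SympSpace` is `±1` on the orthogonal complement of `Kcl`. -/
lemma exists_sign_of_trivial (hw : w ∈ WeylE7)
    (hker : ∀ x, interForm x Kcl = 0 → reduction (w x) = reduction x) :
    ∃ ε : ℤˣ, ∀ x, interForm x Kcl = 0 → w x = (ε : ℤ) • x := by
  obtain ⟨ε, h0⟩ : ∃ ε : ℤˣ, w (simpleRoot 0) = (ε : ℤ) • simpleRoot 0 := by
    rcases map_root_eq_or_eq_neg hw hker (isRoot_simpleRoot 0) with h | h
    · exact ⟨1, by simp [h]⟩
    · exact ⟨-1, by simp [h]⟩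
  have step {i : Fin 7} (j : Fin 7) (hij : interForm (simpleRoot i) (simpleRoot j) ≠ 0)
      (h : w (simpleRoot i) = (ε : ℤ) • simpleRoot i) :
      w (simpleRoot j) = (ε : ℤ) • simpleRoot j :=
    map_root_eq_smul_of_adjacent hw hker (isRoot_simpleRoot j) hij h
  have h1 := step 1 (by decide) h0
  have h2 := step 2 (by decide) h1
  have h3 := step 3 (by decide) h2
  have h4 := step 4 (by decide) h1
  have h5 := step 5 (by decide) h4
  have h6 := step 6 (by decide) h5
  have hall (i : Fin 7) : w (simpleRoot i) = (ε : ℤ) • simpleRoot i := by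
    fin_cases i
    exacts [h0, h1, h2, h3, h4, h5, h6]
  refine ⟨ε, fun x hx => ?_⟩
  obtain ⟨c, rfl⟩ := eq_sum_simpleRoot hx
  simp only [map_sum, map_smul, hall, Finset.smul_sum, smul_comm (ε : ℤ)]

/-- An element of the Weyl group is determined by its action on the orthogonal complement of
`Kcl`. -/
lemma ext_of_mem_WeylE7 {w w' : (Fin 8 → ℤ) ≃ₗ[ℤ] (Fin 8 → ℤ)} (hw : w ∈ WeylE7)
    (hw' : w' ∈ WeylE7) (h : ∀ x, interForm x Kcl = 0 → w x = w' x) : w = w' := by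
  refine LinearEquiv.ext fun x => ?_
  have hx := h ((2 : ℤ) • x - interForm x Kcl • Kcl) (by
    rw [interForm_sub_left, interForm_smul_left, interForm_smul_left, interForm_Kcl_Kcl]
    ring)
  rw [map_sub, map_sub, map_smul, map_smul, map_smul, map_smul, map_Kcl_of_mem hw,
    map_Kcl_of_mem hw', sub_left_inj] at hx
  exact smul_right_injective _ two_ne_zero hx

end Kernel

/-- The sign group `{±1}` is cyclic of order two. -/
noncomputable def unitsIntEquiv : ℤˣ ≃* Multiplicative (ZMod 2) :=
  mulEquivOfPrimeCardEq (p := 2) (by simp [Nat.card_eq_fintype_card])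
    (by simp [Nat.card_eq_fintype_card])

/-- The determinant on the Weyl group, with values in `ℤ/2`. -/
noncomputable def detSign : WeylE7 →* Multiplicative (ZMod 2) :=
  unitsIntEquiv.toMonoidHom.comp (LinearEquiv.det.comp WeylE7.subtype)

lemma detSign_eq_one_iff (w : WeylE7) : detSign w = 1 ↔ LinearEquiv.det w.1 = 1 :=
  unitsIntEquiv.map_eq_one_iff

lemma eq_one_or_eq_ofAdd_one (a : Multiplicative (ZMod 2)) :
    a = 1 ∨ a = Multiplicative.ofAdd 1 := by
  revert a; decide

/-- `W(E₇) ≅ Sp₆(𝔽₂) × ℤ/2`, the `ℤ/2` factor being generated by the central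
element `-1` (acting as negation on the `E₇` root lattice `K₇^⊥`). -/
theorem stmt13 :
    ∃ iso : WeylE7 ≃* Sp6 × Multiplicative (ZMod 2),
      ∃ w₀ : WeylE7,
        (∀ x : Fin 8 → ℤ, interForm x Kcl = 0 → w₀.1 x = -x) ∧
        iso w₀ = (1, Multiplicative.ofAdd 1) := by
  obtain ⟨w, hw, hdet, hwx⟩ := exists_neg_mem_WeylE7
  have hneg (x : Fin 8 → ℤ) (hx : interForm x Kcl = 0) : w x = -x := by
    rw [hwx, hx, zero_smul, zero_sub]
  have hrep : symplecticRep ⟨w, hw⟩ = 1 := by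
    refine Subtype.ext (LinearEquiv.ext fun v => ?_)
    change reduction (w (lift v)) = v
    rw [hneg _ (interForm_lift_Kcl v), map_neg, reduction_lift]
    ext i <;> exact ZMod.neg_eq_self_mod_two _
  have hsign : detSign ⟨w, hw⟩ = Multiplicative.ofAdd 1 := by
    refine (eq_one_or_eq_ofAdd_one _).resolve_left fun h => ?_
    rw [detSign_eq_one_iff, hdet] at h
    exact absurd h (by decide)
  have hinj : Function.Injective (symplecticRep.prod detSign) := by
    rw [injective_iff_map_eq_one]
    rintro ⟨a, ha⟩ h
    obtain ⟨h₁, h₂⟩ := Prod.mk.inj h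
    obtain ⟨ε, hε⟩ := exists_sign_of_trivial ha fun x hx => by
      have := symplecticRep_reduction ⟨a, ha⟩ hx
      rw [h₁] at this
      exact this.symm
    replace h₂ : LinearEquiv.det a = 1 := (detSign_eq_one_iff _).mp h₂
    rcases Int.units_eq_one_or ε with rfl | rfl
    · exact Subtype.ext (ext_of_mem_WeylE7 ha (one_mem _) fun x hx => by simp [hε x hx])
    · have haw : a = w := ext_of_mem_WeylE7 ha hw fun x hx => by simp [hε x hx, hneg x hx]
      rw [haw, hdet] at h₂
      exact absurd h₂ (by decide)
  have hsurj : Function.Surjective (symplecticRep.prod detSign) := by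
    rintro ⟨σ, a⟩
    obtain ⟨b, rfl⟩ := symplecticRep_surjective σ
    by_cases hb : detSign b = a
    · exact ⟨b, Prod.ext rfl hb⟩
    · refine ⟨b * ⟨w, hw⟩, Prod.ext ?_ ?_⟩
      · simp [hrep]
      · have key : ∀ c a : Multiplicative (ZMod 2), c ≠ a → c * Multiplicative.ofAdd 1 = a := by
          decide
        simpa [hsign] using key _ _ hb
  exact ⟨MulEquiv.ofBijective _ ⟨hinj, hsurj⟩, ⟨w, hw⟩, hneg, Prod.ext hrep hsign⟩
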